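/- Let X be compact and geodesic metric spaces X_n (n ∈ ℕ ∪ {∞}) be isometrically embedded in a compact space Y. Then the images X_n converge to X_∞ in Hausdorff distance if and only if the (extended) kinetic energy functionals KE_{X_n} Γ-converge to KE_{X_∞} on C([0,1],Y) with respect to uniform convergence. -/

import Mathlib

open Filter Topology MeasureTheory Set Metric
open scoped ENNReal NNReal

/-- Upper difference quotient of a curve; for an absolutely continuous curve it coincides a.e.
with the metric speed `|γ̇_t|`. -/
noncomputable def speedE {Y : Type*} [MetricSpace Y] (γ : ℝ → Y) (t : ℝ) : ℝ≥0∞ :=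
  Filter.limsup (fun h : ℝ => ENNReal.ofReal (dist (γ (t + h)) (γ t) / |h|)) (𝓝[≠] 0)

/-- A curve `γ : [0,1] → Y` is absolutely continuous. -/
def ACCurve {Y : Type*} [MetricSpace Y] (γ : ℝ → Y) : Prop :=
  ∃ f : ℝ → ℝ, IntegrableOn f (Icc (0:ℝ) 1) ∧
    ∀ t s : ℝ, t ∈ Icc (0:ℝ) 1 → s ∈ Icc (0:ℝ) 1 → t ≤ s →
      dist (γ t) (γ s) ≤ ∫ r in t..s, f r

open Classical in
/-- Kinetic energy `(1/2)∫_0^1 |γ̇|²`, `+∞` for non absolutely continuous curves. -/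
noncomputable def kineticEnergy {Y : Type*} [MetricSpace Y] (γ : ℝ → Y) : ℝ≥0∞ :=
  if ACCurve γ then (1/2 : ℝ≥0∞) * ∫⁻ t in Icc (0:ℝ) 1, (speedE γ t) ^ 2 else ⊤

open Classical in
/-- The extension `KE-hat` of the kinetic energy of the subspace `A ⊆ Y` to curves in `Y`:
it equals the kinetic energy if the curve lies in `A` on `[0,1]`, and `+∞` otherwise. -/
noncomputable def kineticEnergyIn {Y : Type*} [MetricSpace Y] (A : Set Y) (γ : ℝ → Y) : ℝ≥0∞ :=
  if ∀ t ∈ Icc (0:ℝ) 1, γ t ∈ A then kineticEnergy γ else ⊤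

/-- A subset `A` of a metric space is geodesic: any two of its points are joined by a
constant-speed geodesic with values in `A`. -/
def GeodesicSubset {Y : Type*} [MetricSpace Y] (A : Set Y) : Prop :=
  ∀ p ∈ A, ∀ q ∈ A, ∃ γ : ℝ → Y, γ 0 = p ∧ γ 1 = q ∧ (∀ t ∈ Icc (0:ℝ) 1, γ t ∈ A) ∧
    ∀ t ∈ Icc (0:ℝ) 1, ∀ s ∈ Icc (0:ℝ) 1, dist (γ t) (γ s) = |s - t| * dist p q


lemma aux_deriv_le_speedE {Y : Type*} [MetricSpace Y] (γ : ℝ → Y) (x : Y) (r : ℝ)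
    (h : DifferentiableAt ℝ (fun r => dist x (γ r)) r) :
    ‖deriv (fun r => dist x (γ r)) r‖ₑ ≤ speedE γ r := by
  have h1 := h.hasDerivAt.tendsto_slope_zero
  have h2 := (h1.enorm).limsup_eq
  rw [← h2]
  unfold speedE
  refine Filter.limsup_le_limsup ?_
  · filter_upwards with t
    rw [Real.enorm_eq_ofReal_abs]
    apply ENNReal.ofReal_le_ofReal
    rw [smul_eq_mul, abs_mul, abs_inv, mul_comm, ← div_eq_mul_inv]
    gcongr
    rw [dist_comm x, dist_comm x]
    exact abs_dist_sub_le _ _ _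

lemma aux_ac_of_le {Y Z : Type*} [PseudoMetricSpace Y] [PseudoMetricSpace Z] {f : ℝ → Y} {g : ℝ → Z} {a b : ℝ}
    (hg : AbsolutelyContinuousOnInterval g a b)
    (h : ∀ t ∈ uIcc a b, ∀ s ∈ uIcc a b, dist (f t) (f s) ≤ dist (g t) (g s)) :
    AbsolutelyContinuousOnInterval f a b := by
  rw [absolutelyContinuousOnInterval_iff] at hg ⊢
  intro ε hε
  obtain ⟨δ, hδ, H⟩ := hg ε hε
  refine ⟨δ, hδ, fun E hE hl => lt_of_le_of_lt ?_ (H E hE hl)⟩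
  apply Finset.sum_le_sum
  intro i hi
  exact h _ (hE.1 i hi).1 _ (hE.1 i hi).2

lemma aux_ACCurve_ac {Y : Type*} [MetricSpace Y] {γ : ℝ → Y} (h : ACCurve γ) :
    AbsolutelyContinuousOnInterval γ 0 1 := by
  obtain ⟨f, hf, H⟩ := h
  have hi : IntervalIntegrable f volume 0 1 :=
    (intervalIntegrable_iff_integrableOn_Icc_of_le zero_le_one).2 hf
  have := hi.absolutelyContinuousOnInterval_intervalIntegral (c := 0) (by simp)
  refine aux_ac_of_le this ?_
  rw [uIcc_of_le zero_le_one]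
  have sub : ∀ t ∈ Icc (0:ℝ) 1, IntervalIntegrable f volume 0 t := fun t ht =>
    hi.mono_set (by rw [uIcc_of_le zero_le_one, uIcc_of_le ht.1]; exact Icc_subset_Icc_right ht.2)
  intro t ht s hs
  rcases le_total t s with hts | hts
  · rw [dist_comm (∫ v in (0:ℝ)..t, f v), Real.dist_eq,
      intervalIntegral.integral_interval_sub_left (sub s hs) (sub t ht)]
    exact (H t s ht hs hts).trans (le_abs_self _)
  · rw [Real.dist_eq,
      intervalIntegral.integral_interval_sub_left (sub t ht) (sub s hs), dist_comm]
    exact (H s t hs ht hts).trans (le_abs_self _)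

lemma aux_CS {f : ℝ → ℝ≥0∞} (μ : Measure ℝ) (hf : AEMeasurable f μ) :
    (∫⁻ r, f r ∂μ) ^ 2 ≤ μ univ * ∫⁻ r, f r ^ 2 ∂μ := by
  have := ENNReal.lintegral_mul_le_Lp_mul_Lq μ (p := 2) (q := 2) ⟨by norm_num, by norm_num, by norm_num⟩ hf
    (aemeasurable_const (b := (1:ℝ≥0∞)))
  simp only [Pi.mul_apply, mul_one, ENNReal.one_rpow, lintegral_const, one_mul] at this
  calc _ ≤ _ := pow_le_pow_left' this 2
    _ = _ := by
      rw [mul_pow, ← ENNReal.rpow_natCast, ← ENNReal.rpow_natCast, ← ENNReal.rpow_mul, ← ENNReal.rpow_mul]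
      norm_num
      rw [mul_comm]

lemma aux_L1 {Y : Type*} [MetricSpace Y] {γ : ℝ → Y} (h : AbsolutelyContinuousOnInterval γ 0 1)
    {t s : ℝ} (ht : 0 ≤ t) (hts : t ≤ s) (hs : s ≤ 1) :
    ENNReal.ofReal (dist (γ t) (γ s)) ^ 2 ≤
      ENNReal.ofReal (s - t) * ∫⁻ r in Ioc t s, speedE γ r ^ 2 := by
  have hφ : AbsolutelyContinuousOnInterval (fun r => dist (γ t) (γ r)) t s := by
    refine aux_ac_of_le (h.mono ?_) ?_
    · rw [uIcc_of_le hts, uIcc_of_le zero_le_one]; exact Icc_subset_Icc ht hs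
    · intro a _ b _
      rw [Real.dist_eq, dist_comm (γ t), dist_comm (γ t)]
      exact abs_dist_sub_le _ _ _
  have h1 := hφ.integral_deriv_eq_sub
  simp only [dist_self, sub_zero] at h1
  have hae : ∀ᵐ r ∂(volume.restrict (Ioc t s)),
      ‖deriv (fun r => dist (γ t) (γ r)) r‖ₑ ^ 2 ≤ speedE γ r ^ 2 := by
    rw [ae_restrict_iff' measurableSet_Ioc]
    filter_upwards [hφ.ae_differentiableAt] with r hr hr'
    rw [uIcc_of_le hts] at hr
    exact pow_le_pow_left' (aux_deriv_le_speedE γ _ r (hr ⟨hr'.1.le, hr'.2⟩)) 2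
  calc _ ≤ (∫⁻ r in Ioc t s, ‖deriv (fun r => dist (γ t) (γ r)) r‖ₑ) ^ 2 := by
        apply pow_le_pow_left'
        rw [← h1, intervalIntegral.integral_of_le hts, ← Real.enorm_of_nonneg]
        · exact enorm_integral_le_lintegral_enorm _
        · rw [← intervalIntegral.integral_of_le hts, h1]; exact dist_nonneg
    _ ≤ _ := aux_CS _ (measurable_deriv _).enorm.aemeasurable
    _ ≤ _ := by
        rw [Measure.restrict_apply_univ, Real.volume_Ioc]
        gcongr 1
        exact lintegral_mono_ae hae

lemma aux_speed_le {Y : Type*} [MetricSpace Y] {γ : ℝ → Y} {e : ℝ → ℝ} {t : ℝ}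
    (hd : DifferentiableAt ℝ e t)
    (h : ∀ᶠ h in 𝓝[≠] (0:ℝ), dist (γ (t + h)) (γ t) ^ 2 ≤ |h| * |e (t + h) - e t|) :
    speedE γ t ^ 2 ≤ ‖deriv e t‖ₑ := by
  have h1 := hd.hasDerivAt.tendsto_slope_zero
  have h2 := (((Real.continuous_sqrt.comp continuous_abs).tendsto _).comp h1)
  have h3 := (ENNReal.tendsto_ofReal h2).limsup_eq
  have h4 : speedE γ t ≤ ENNReal.ofReal (√ |deriv e t|) := by
    refine le_trans ?_ h3.le
    unfold speedE
    refine Filter.limsup_le_limsup ?_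
    filter_upwards [h, self_mem_nhdsWithin] with u hu hu0
    apply ENNReal.ofReal_le_ofReal
    simp only [Function.comp]
    apply Real.le_sqrt_of_sq_le
    have : 0 < |u| := abs_pos.2 hu0
    rw [smul_eq_mul, abs_mul, abs_inv, div_pow, div_le_iff₀ (by positivity)]
    refine hu.trans (le_of_eq ?_)
    field_simp
  calc _ ≤ _ := pow_le_pow_left' h4 2
    _ = _ := by
      rw [← ENNReal.ofReal_pow (Real.sqrt_nonneg _), Real.sq_sqrt (abs_nonneg _), Real.enorm_eq_ofReal_abs]


lemma aux_L2 {Y : Type*} [MetricSpace Y] {γ : ℝ → Y} {e : ℝ → ℝ}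
    (hac : AbsolutelyContinuousOnInterval γ 0 1) (he : MonotoneOn e (Icc 0 1))
    (h : ∀ t s : ℝ, 0 ≤ t → t ≤ s → s ≤ 1 → dist (γ t) (γ s) ^ 2 ≤ (s - t) * (e s - e t)) :
    ACCurve γ ∧ ∫⁻ t in Icc (0:ℝ) 1, speedE γ t ^ 2 ≤ ENNReal.ofReal (e 1 - e 0) := by
  have hint : IntervalIntegrable (deriv e) volume 0 1 :=
    MonotoneOn.intervalIntegrable_deriv (by rwa [uIcc_of_le zero_le_one])
  have hsp : ∀ᵐ r : ℝ, r ∈ Ioo (0:ℝ) 1 → speedE γ r ^ 2 ≤ ‖deriv e r‖ₑ := by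
    filter_upwards [he.ae_differentiableWithinAt_of_mem] with r hr hr'
    have hd : DifferentiableAt ℝ e r :=
      (hr ⟨hr'.1.le, hr'.2.le⟩).differentiableAt (Icc_mem_nhds hr'.1 hr'.2)
    apply aux_speed_le hd
    have hc : Tendsto (fun u : ℝ => r + u) (𝓝[≠] 0) (𝓝 r) := by
      have : Tendsto (fun u : ℝ => r + u) (𝓝 0) (𝓝 (r + 0)) :=
        (continuous_const.add continuous_id).tendsto 0
      rw [add_zero] at this
      exact this.mono_left nhdsWithin_le_nhds
    filter_upwards [hc (Icc_mem_nhds hr'.1 hr'.2)] with u hu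
    have hu : r + u ∈ Icc (0:ℝ) 1 := hu
    rcases le_total 0 u with h0 | h0
    · have := h r (r + u) hr'.1.le (by linarith) hu.2
      rw [dist_comm, abs_of_nonneg h0]
      refine this.trans ?_
      rw [add_sub_cancel_left]
      gcongr
      exact le_abs_self _
    · have := h (r + u) r hu.1 (by linarith) hr'.2.le
      rw [abs_of_nonpos h0, abs_sub_comm]
      refine this.trans ?_
      rw [sub_add_cancel_left]
      have : 0 ≤ -u := by linarith
      gcongr
      exact le_abs_self _
  constructor
  · refine ⟨fun r => 1 + |deriv e r|, ?_, ?_⟩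
    · rw [← intervalIntegrable_iff_integrableOn_Icc_of_le zero_le_one]
      exact (intervalIntegrable_const).add hint.abs
    · intro t s ht hs hts
      have hφ : AbsolutelyContinuousOnInterval (fun r => dist (γ t) (γ r)) t s := by
        refine aux_ac_of_le (hac.mono ?_) ?_
        · rw [uIcc_of_le hts, uIcc_of_le zero_le_one]; exact Icc_subset_Icc ht.1 hs.2
        · intro a _ b _
          rw [Real.dist_eq, dist_comm (γ t), dist_comm (γ t)]
          exact abs_dist_sub_le _ _ _
      have h1 := hφ.integral_deriv_eq_sub
      simp only [dist_self, sub_zero] at h1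
      rw [← h1]
      apply intervalIntegral.integral_mono_ae_restrict hts hφ.intervalIntegrable_deriv
      · refine ((intervalIntegrable_const).add hint.abs).mono_set ?_
        rw [uIcc_of_le hts, uIcc_of_le zero_le_one]; exact Icc_subset_Icc ht.1 hs.2
      · rw [← restrict_Ioo_eq_restrict_Icc]
        refine (ae_restrict_iff' measurableSet_Ioo).2 ?_
        filter_upwards [hφ.ae_differentiableAt, hsp] with r hr hr2 hr'
        rw [uIcc_of_le hts] at hr
        have a1 := aux_deriv_le_speedE γ (γ t) r (hr ⟨hr'.1.le, hr'.2.le⟩)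
        have a2 := hr2 ⟨ht.1.trans_lt hr'.1, hr'.2.trans_le hs.2⟩
        have a3 := (pow_le_pow_left' a1 2).trans a2
        rw [Real.enorm_eq_ofReal_abs, Real.enorm_eq_ofReal_abs, ← ENNReal.ofReal_pow (abs_nonneg _),
          ENNReal.ofReal_le_ofReal_iff (abs_nonneg _), sq_abs] at a3
        nlinarith [sq_nonneg (deriv (fun r => dist (γ t) (γ r)) r - 1)]
  · obtain ⟨G, hGf, hG, hG'⟩ := he.exists_tendsto_deriv_liminf_lintegral_enorm_le zero_le_one
    refine le_trans ?_ ((lintegral_enorm_le_liminf_of_tendsto hGf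
      (fun n ↦ (hG n).aemeasurable.enorm)).trans hG')
    apply lintegral_mono_ae
    rw [← restrict_Ioo_eq_restrict_Icc]
    exact (ae_restrict_iff' measurableSet_Ioo).2 hsp

lemma aux_single {Y : Type*} [MetricSpace Y] {γ : ℝ → Y} {C : ℝ} (hC : 0 ≤ C)
    (hac : ACCurve γ) (hE : ∫⁻ t in Icc (0:ℝ) 1, speedE γ t ^ 2 ≤ ENNReal.ofReal C) :
    ∃ e : ℝ → ℝ, (∀ t ∈ Icc (0:ℝ) 1, e t ∈ Icc 0 C) ∧
      (∀ t s : ℝ, 0 ≤ t → t ≤ s → s ≤ 1 → e t ≤ e s ∧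
        dist (γ t) (γ s) ^ 2 ≤ (s - t) * (e s - e t)) ∧
      (∀ E ∈ AbsolutelyContinuousOnInterval.disjWithin 0 1, ∀ l : ℝ, 0 < l →
        ∑ i ∈ Finset.range E.1, dist (γ (E.2 i).1) (γ (E.2 i).2) ≤
          l * C + (∑ i ∈ Finset.range E.1, dist (E.2 i).1 (E.2 i).2) / l) := by
  have hac' := aux_ACCurve_ac hac
  have sub : ∀ S : Set ℝ, S ⊆ Icc 0 1 → ∫⁻ t in S, speedE γ t ^ 2 ≤ ENNReal.ofReal C :=
    fun S hS => (lintegral_mono_set hS).trans hE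
  have fin : ∀ S : Set ℝ, S ⊆ Icc 0 1 → ∫⁻ t in S, speedE γ t ^ 2 ≠ ⊤ :=
    fun S hS => ((sub S hS).trans_lt ENNReal.ofReal_lt_top).ne
  have iocsub : ∀ t s : ℝ, 0 ≤ t → s ≤ 1 → Ioc t s ⊆ Icc 0 1 := fun t s ht hs r hr =>
    ⟨ht.trans hr.1.le, hr.2.trans hs⟩
  have key : ∀ t s : ℝ, 0 ≤ t → t ≤ s → s ≤ 1 →
      dist (γ t) (γ s) ^ 2 ≤ (s - t) * (∫⁻ r in Ioc t s, speedE γ r ^ 2).toReal := by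
    intro t s ht hts hs
    have h1 := aux_L1 hac' ht hts hs
    have h2 := ENNReal.toReal_mono
      (ENNReal.mul_ne_top ENNReal.ofReal_ne_top (fin _ (iocsub t s ht hs))) h1
    rwa [ENNReal.toReal_mul, ENNReal.toReal_pow, ENNReal.toReal_ofReal dist_nonneg,
      ENNReal.toReal_ofReal (by linarith)] at h2
  refine ⟨fun t => (∫⁻ r in Ioc 0 t, speedE γ r ^ 2).toReal, ?_, ?_, ?_⟩
  · intro t ht
    exact ⟨ENNReal.toReal_nonneg, ENNReal.toReal_le_of_le_ofReal hC (sub _ (iocsub 0 t le_rfl ht.2))⟩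
  · intro t s ht hts hs
    have e1 : (∫⁻ r in Ioc 0 s, speedE γ r ^ 2).toReal = (∫⁻ r in Ioc 0 t, speedE γ r ^ 2).toReal
        + (∫⁻ r in Ioc t s, speedE γ r ^ 2).toReal := by
      rw [← ENNReal.toReal_add (fin _ (iocsub 0 t le_rfl (hts.trans hs))) (fin _ (iocsub t s ht hs)),
        ← lintegral_union measurableSet_Ioc (Ioc_disjoint_Ioc_of_le le_rfl), Ioc_union_Ioc_eq_Ioc ht hts]
    simp only [e1]
    refine ⟨by linarith [ENNReal.toReal_nonneg (a := ∫⁻ r in Ioc t s, speedE γ r ^ 2)], ?_⟩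
    rw [add_sub_cancel_left]
    exact key t s ht hts hs
  · intro E hE' l hl
    obtain ⟨h1, h2⟩ := hE'
    rw [uIcc_of_le zero_le_one] at h1
    have k2 : ∀ i ∈ Finset.range E.1, dist (γ (E.2 i).1) (γ (E.2 i).2) ≤
        l * (∫⁻ r in uIoc (E.2 i).1 (E.2 i).2, speedE γ r ^ 2).toReal +
          dist (E.2 i).1 (E.2 i).2 / l := by
      intro i hi
      obtain ⟨ha, hb⟩ := h1 i hi
      have k3 : dist (γ (E.2 i).1) (γ (E.2 i).2) ^ 2 ≤ dist (E.2 i).1 (E.2 i).2 *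
          (∫⁻ r in uIoc (E.2 i).1 (E.2 i).2, speedE γ r ^ 2).toReal := by
        rcases le_total (E.2 i).1 (E.2 i).2 with hab | hab
        · rw [uIoc_of_le hab, dist_comm (E.2 i).1, Real.dist_eq, abs_of_nonneg (by linarith)]
          exact key _ _ ha.1 hab hb.2
        · rw [uIoc_of_ge hab, Real.dist_eq, abs_of_nonneg (by linarith), dist_comm]
          exact key _ _ hb.1 hab ha.2
      set D := dist (γ (E.2 i).1) (γ (E.2 i).2)
      set x := dist (E.2 i).1 (E.2 i).2
      set w := (∫⁻ r in uIoc (E.2 i).1 (E.2 i).2, speedE γ r ^ 2).toReal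
      have hx : 0 ≤ x := dist_nonneg
      have hw : 0 ≤ w := ENNReal.toReal_nonneg
      apply abs_le_of_sq_le_sq' _ (by positivity) |>.2
      have : (l * w) * (x / l) = x * w := by field_simp
      nlinarith [sq_nonneg (l * w - x / l), sq_nonneg (l * w + x / l), mul_nonneg hx hw]
    refine (Finset.sum_le_sum k2).trans ?_
    rw [Finset.sum_add_distrib, ← Finset.mul_sum, ← Finset.sum_div]
    gcongr
    have usub : ∀ i ∈ Finset.range E.1, uIoc (E.2 i).1 (E.2 i).2 ⊆ Icc 0 1 := by
      intro i hi
      obtain ⟨ha, hb⟩ := h1 i hi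
      exact uIoc_subset_uIcc.trans (uIcc_subset_Icc ha hb)
    rw [← ENNReal.toReal_sum (fun i hi => fin _ (usub i hi)),
      ← lintegral_biUnion_finset h2 (fun _ _ => measurableSet_uIoc)]
    exact ENNReal.toReal_le_of_le_ofReal hC (sub _ (iUnion₂_subset usub))

lemma aux_lsc {Y : Type*} [MetricSpace Y] {γ : ℝ → Y} {g : ℕ → ℝ → Y} (U : Ultrafilter ℕ)
    {C : ℝ} (hC : 0 ≤ C)
    (hconv : ∀ t ∈ Icc (0:ℝ) 1, Tendsto (fun n => g n t) U (𝓝 (γ t)))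
    (hg : ∀ᶠ n in (U : Filter ℕ), ACCurve (g n) ∧
      ∫⁻ t in Icc (0:ℝ) 1, speedE (g n) t ^ 2 ≤ ENNReal.ofReal C) :
    ACCurve γ ∧ ∫⁻ t in Icc (0:ℝ) 1, speedE γ t ^ 2 ≤ ENNReal.ofReal C := by
  have hex : ∀ n, ∃ e : ℝ → ℝ, (ACCurve (g n) ∧
      ∫⁻ t in Icc (0:ℝ) 1, speedE (g n) t ^ 2 ≤ ENNReal.ofReal C) →
      (∀ t ∈ Icc (0:ℝ) 1, e t ∈ Icc 0 C) ∧
      (∀ t s : ℝ, 0 ≤ t → t ≤ s → s ≤ 1 → e t ≤ e s ∧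
        dist (g n t) (g n s) ^ 2 ≤ (s - t) * (e s - e t)) ∧
      (∀ E ∈ AbsolutelyContinuousOnInterval.disjWithin 0 1, ∀ l : ℝ, 0 < l →
        ∑ i ∈ Finset.range E.1, dist (g n (E.2 i).1) (g n (E.2 i).2) ≤
          l * C + (∑ i ∈ Finset.range E.1, dist (E.2 i).1 (E.2 i).2) / l) := by
    intro n
    by_cases h : ACCurve (g n) ∧ ∫⁻ t in Icc (0:ℝ) 1, speedE (g n) t ^ 2 ≤ ENNReal.ofReal C
    · obtain ⟨e, he⟩ := aux_single hC h.1 h.2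
      exact ⟨e, fun _ => he⟩
    · exact ⟨0, fun h' => absurd h' h⟩
  choose e he using hex
  have hlim : ∀ t : ℝ, ∃ x : ℝ, t ∈ Icc (0:ℝ) 1 → x ∈ Icc 0 C ∧ Tendsto (fun n => e n t) U (𝓝 x) := by
    intro t
    by_cases ht : t ∈ Icc (0:ℝ) 1
    · obtain ⟨x, hx, hx'⟩ := (isCompact_Icc (a := (0:ℝ)) (b := C)).ultrafilter_le_nhds
        (U.map (fun n => e n t)) (by
          rw [le_principal_iff]
          change ∀ᶠ n in (U : Filter ℕ), e n t ∈ Icc 0 C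
          filter_upwards [hg] with n hn using (he n hn).1 t ht)
      exact ⟨x, fun _ => ⟨hx, hx'⟩⟩
    · exact ⟨0, fun h => absurd h ht⟩
  choose e' he' using hlim
  have hac : AbsolutelyContinuousOnInterval γ 0 1 := by
    have hb : ∀ E ∈ AbsolutelyContinuousOnInterval.disjWithin 0 1, ∀ l : ℝ, 0 < l →
        ∑ i ∈ Finset.range E.1, dist (γ (E.2 i).1) (γ (E.2 i).2) ≤
          l * C + (∑ i ∈ Finset.range E.1, dist (E.2 i).1 (E.2 i).2) / l := by
      intro E hE l hl
      refine le_of_tendsto (f := fun n => ∑ i ∈ Finset.range E.1, dist (g n (E.2 i).1) (g n (E.2 i).2))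
        (x := (U : Filter ℕ)) ?_ ?_
      · apply tendsto_finsetSum
        intro i hi
        have := hE.1 i hi
        rw [uIcc_of_le zero_le_one] at this
        exact (hconv _ this.1).dist (hconv _ this.2)
      · filter_upwards [hg] with n hn using (he n hn).2.2 E hE l hl
    rw [absolutelyContinuousOnInterval_iff]
    intro ε hε
    have hl : 0 < ε / (2 * (C + 1)) := by positivity
    refine ⟨(ε / 2) * (ε / (2 * (C + 1))), by positivity, fun E hE hs => ?_⟩
    refine (hb E hE _ hl).trans_lt ?_
    have h1 : (∑ i ∈ Finset.range E.1, dist (E.2 i).1 (E.2 i).2) / (ε / (2 * (C + 1))) < ε / 2 := by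
      rw [div_lt_iff₀ hl]; exact hs
    have h2 : ε / (2 * (C + 1)) * C ≤ ε / 2 := by
      rw [div_mul_eq_mul_div, div_le_div_iff₀ (by positivity) (by positivity)]
      nlinarith
    linarith
  have hmain : ∀ t s : ℝ, 0 ≤ t → t ≤ s → s ≤ 1 → e' t ≤ e' s ∧
        dist (γ t) (γ s) ^ 2 ≤ (s - t) * (e' s - e' t) := by
    intro t s ht hts hs
    have ht' : t ∈ Icc (0:ℝ) 1 := ⟨ht, hts.trans hs⟩
    have hs' : s ∈ Icc (0:ℝ) 1 := ⟨ht.trans hts, hs⟩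
    constructor
    · refine le_of_tendsto_of_tendsto (he' t ht').2 (he' s hs').2 ?_
      filter_upwards [hg] with n hn using ((he n hn).2.1 t s ht hts hs).1
    · refine le_of_tendsto_of_tendsto (((hconv t ht').dist (hconv s hs')).pow 2)
        (((he' s hs').2.sub (he' t ht').2).const_mul (s - t)) ?_
      filter_upwards [hg] with n hn using ((he n hn).2.1 t s ht hts hs).2
  obtain ⟨r1, r2⟩ := aux_L2 hac (e := e') (fun t ht s hs hts => (hmain t s ht.1 hts hs.2).1)
    (fun t s ht hts hs => (hmain t s ht hts hs).2)
  refine ⟨r1, r2.trans (ENNReal.ofReal_le_ofReal ?_)⟩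
  have a := (he' 0 (by simp)).1.1
  have b := (he' 1 (by simp)).1.2
  linarith


lemma aux_piecewise {Y : Type*} [MetricSpace Y] {A : Set Y} (hA : GeodesicSubset A)
    (p : ℕ → Y) (hp : ∀ i, p i ∈ A) (K : ℝ) (hK : ∀ i, dist (p i) (p (i + 1)) ≤ K) :
    ∃ G : ℝ → Y, (∀ u, 0 ≤ u → G u ∈ A) ∧ (∀ i : ℕ, G i = p i) ∧
      (∀ i : ℕ, ∀ u ∈ Icc (i:ℝ) (i + 1), ∀ v ∈ Icc (i:ℝ) (i + 1),
        dist (G u) (G v) = |v - u| * dist (p i) (p (i + 1))) ∧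
      (∀ u v, 0 ≤ u → u ≤ v → dist (G u) (G v) ≤ K * (v - u)) := by
  choose c hc0 hc1 hcA hcd using fun i => hA (p i) (hp i) (p (i + 1)) (hp (i + 1))
  have hloc : ∀ i : ℕ, ∀ u ∈ Icc (i:ℝ) (i + 1), c ⌊u⌋₊ (u - ⌊u⌋₊) = c i (u - i) := by
    intro i u hu
    rcases hu.2.lt_or_eq with h | h
    · have : ⌊u⌋₊ = i := (Nat.floor_eq_iff (i.cast_nonneg.trans hu.1)).2 ⟨hu.1, h⟩
      rw [this]
    · have : ⌊u⌋₊ = i + 1 := by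
        rw [h]; exact_mod_cast Nat.floor_natCast (R := ℝ) (i + 1)
      rw [this, h]
      push_cast
      rw [sub_self, add_sub_cancel_left, hc0, hc1]
  have hiso : ∀ i : ℕ, ∀ u ∈ Icc (i:ℝ) (i + 1), ∀ v ∈ Icc (i:ℝ) (i + 1),
        dist (c ⌊u⌋₊ (u - ⌊u⌋₊)) (c ⌊v⌋₊ (v - ⌊v⌋₊)) = |v - u| * dist (p i) (p (i + 1)) := by
    intro i u hu v hv
    rw [hloc i u hu, hloc i v hv, hcd i _ ⟨by linarith [hu.1], by linarith [hu.2]⟩ _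
      ⟨by linarith [hv.1], by linarith [hv.2]⟩]
    congr 2
    ring
  refine ⟨fun u => c ⌊u⌋₊ (u - ⌊u⌋₊), ?_, ?_, hiso, ?_⟩
  · intro u hu
    exact hcA _ _ ⟨by linarith [Nat.floor_le hu], by linarith [Nat.lt_floor_add_one u]⟩
  · intro i
    simp [hc0]
  · have hind : ∀ m : ℕ, ∀ u v : ℝ, 0 ≤ u → u ≤ v → ⌊v⌋₊ ≤ ⌊u⌋₊ + m →
        dist (c ⌊u⌋₊ (u - ⌊u⌋₊)) (c ⌊v⌋₊ (v - ⌊v⌋₊)) ≤ K * (v - u) := by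
      intro m
      induction m with
      | zero =>
        intro u v hu huv hm
        have e : ⌊v⌋₊ = ⌊u⌋₊ := le_antisymm hm (Nat.floor_mono huv)
        rw [hiso ⌊u⌋₊ u ⟨Nat.floor_le hu, (Nat.lt_floor_add_one u).le⟩ v
          ⟨(Nat.floor_le hu).trans huv, by rw [← e]; exact (Nat.lt_floor_add_one v).le⟩,
          abs_of_nonneg (by linarith), mul_comm]
        have := hK ⌊u⌋₊
        have : 0 ≤ v - u := by linarith
        gcongr
      | succ m ih =>
        intro u v hu huv hm
        by_cases h : ⌊v⌋₊ ≤ ⌊u⌋₊ + m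
        · exact ih u v hu huv h
        set w : ℝ := ((⌊u⌋₊ + 1 : ℕ) : ℝ) with hw
        have hfw : ⌊w⌋₊ = ⌊u⌋₊ + 1 := Nat.floor_natCast _
        have huw : u ≤ w := by rw [hw]; push_cast; exact (Nat.lt_floor_add_one u).le
        have hwv : w ≤ v := by
          rw [hw]
          exact (Nat.cast_le.2 (by omega)).trans (Nat.floor_le (hu.trans huv))
        have h1 := ih w v (hu.trans huw) hwv (by omega)
        have h2 := hiso ⌊u⌋₊ u ⟨Nat.floor_le hu, (Nat.lt_floor_add_one u).le⟩ w
          ⟨(Nat.floor_le hu).trans huw, by rw [hw]; push_cast; exact le_rfl⟩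
        have h3 := hK ⌊u⌋₊
        have h4 : |w - u| * dist (p ⌊u⌋₊) (p (⌊u⌋₊ + 1)) ≤ K * (w - u) := by
          rw [abs_of_nonneg (by linarith), mul_comm]
          have : 0 ≤ w - u := by linarith
          gcongr
        have h5 := dist_triangle (c ⌊u⌋₊ (u - ⌊u⌋₊)) (c ⌊w⌋₊ (w - ⌊w⌋₊)) (c ⌊v⌋₊ (v - ⌊v⌋₊))
        nlinarith
    intro u v hu huv
    exact hind ⌊v⌋₊ u v hu huv (by omega)

lemma aux_recover {Y : Type*} [MetricSpace Y] [CompactSpace Y] {A : Set Y} (hA : GeodesicSubset A)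
    {γ : ℝ → Y} {C : ℝ} (hC : 0 ≤ C) (hac : ACCurve γ)
    (hE : ∫⁻ t in Icc (0:ℝ) 1, speedE γ t ^ 2 ≤ ENNReal.ofReal C)
    {N : ℕ} (hN : 0 < N) {δ : ℝ} (hδ : 0 < δ)
    (hnear : ∀ t ∈ Icc (0:ℝ) 1, ∃ y ∈ A, dist (γ t) y ≤ δ) :
    ∃ g : ℝ → Y, ContinuousOn g (Icc 0 1) ∧
      kineticEnergyIn A g ≤ 1 / 2 * ENNReal.ofReal ((1 + N * δ) * C + 4 * (N * δ) ^ 2 + 4 * (N * δ)) ∧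
      ∀ ω : ℝ, (∀ s ∈ Icc (0:ℝ) 1, ∀ t ∈ Icc (0:ℝ) 1, |s - t| ≤ 1 / N → dist (γ s) (γ t) ≤ ω) →
        ∀ t ∈ Icc (0:ℝ) 1, dist (γ t) (g t) ≤ 2 * ω + 3 * δ := by
  have hN' : (0:ℝ) < N := Nat.cast_pos.2 hN
  obtain ⟨e, he1, he2, -⟩ := aux_single hC hac hE
  have hmin : ∀ i : ℕ, min ((i:ℝ) / N) 1 ∈ Icc (0:ℝ) 1 := fun i =>
    ⟨le_min (by positivity) zero_le_one, min_le_right _ _⟩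
  choose p hpA hp using fun i : ℕ => hnear _ (hmin i)
  obtain ⟨G, hGA, hGp, hGiso, hGlip⟩ := aux_piecewise hA p hpA (diam (univ : Set Y))
    (fun i => dist_le_diam_of_mem isCompact_univ.isBounded (mem_univ _) (mem_univ _))
  set K := diam (univ : Set Y)
  have hK0 : 0 ≤ K := diam_nonneg
  have hdl : ∀ t s : ℝ, 0 ≤ t → t ≤ s → dist (G (N * t)) (G (N * s)) ≤ (K * N) * (s - t) := by
    intro t s ht hts
    have := hGlip (N * t) (N * s) (by positivity) (by gcongr)
    refine this.trans (le_of_eq (by ring))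
  have hmem : ∀ i < N, ∀ t ∈ Icc ((i:ℝ) / N) ((i + 1) / N), (N * t) ∈ Icc (i:ℝ) (i + 1) := by
    intro i hi t ht
    have h1 := ht.1
    have h2 := ht.2
    rw [div_le_iff₀ hN'] at h1
    rw [le_div_iff₀ hN'] at h2
    constructor <;> linarith
  have hcover : ∀ t ∈ Icc (0:ℝ) 1, ∃ i < N, t ∈ Icc ((i:ℝ) / N) ((i + 1) / N) := by
    intro t ht
    rcases ht.2.lt_or_eq with h | h
    · refine ⟨⌊N * t⌋₊, ?_, ?_, ?_⟩
      · rw [Nat.floor_lt (mul_nonneg hN'.le ht.1)]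
        nlinarith
      · rw [div_le_iff₀ hN', mul_comm t]; exact Nat.floor_le (mul_nonneg hN'.le ht.1)
      · rw [le_div_iff₀ hN', mul_comm t]; exact (Nat.lt_floor_add_one _).le
    · refine ⟨N - 1, by omega, ?_⟩
      rw [Nat.cast_sub hN, h, Nat.cast_one, sub_add_cancel, div_self hN'.ne', sub_div,
        div_self hN'.ne']
      exact ⟨by linarith [show (0:ℝ) < 1 / N by positivity], le_rfl⟩
  have hmin1 : ∀ i : ℕ, i ≤ N → min ((i:ℝ) / N) 1 = i / N := fun i hi =>
    min_eq_left ((div_le_one hN').2 (Nat.cast_le.2 hi))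
  -- bound on consecutive distances
  have hL : ∀ i : ℕ, i < N → dist (p i) (p (i + 1)) ≤
      dist (γ ((i:ℝ) / N)) (γ (((i + 1 : ℕ) : ℝ) / N)) + 2 * δ := by
    intro i hi
    have h1 := hp i
    have h2 := hp (i + 1)
    rw [hmin1 i hi.le] at h1
    rw [hmin1 (i + 1) hi] at h2
    have := dist_triangle4 (p i) (γ ((i:ℝ) / N)) (γ (((i + 1 : ℕ) : ℝ) / N)) (p (i + 1))
    rw [dist_comm (p i) (γ _)] at this
    linarith
  have hlipOn : LipschitzOnWith ⟨K * N, by positivity⟩ (fun t => G (N * t)) (Icc 0 1) := by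
    apply LipschitzOnWith.of_dist_le_mul
    intro t ht s hs
    rcases le_total t s with h | h
    · rw [dist_comm t, Real.dist_eq, abs_of_nonneg (by linarith)]
      exact hdl t s ht.1 h
    · rw [Real.dist_eq, abs_of_nonneg (by linarith), dist_comm]
      exact hdl s t hs.1 h
  refine ⟨fun t => G (N * t), hlipOn.continuousOn, ?_, ?_⟩
  · have hacg : ACCurve (fun t => G (N * t)) := by
      refine ⟨fun _ => K * N, ?_, ?_⟩
      · exact integrableOn_const (by simp)
      · intro t s ht hs hts
        rw [intervalIntegral.integral_const, smul_eq_mul, mul_comm]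
        exact hdl t s ht.1 hts
    rw [kineticEnergyIn, if_pos (fun t ht => hGA _ (mul_nonneg hN'.le ht.1)), kineticEnergy,
      if_pos hacg]
    gcongr 1
    have hspeed : ∀ i < N, ∀ t ∈ Ioo ((i:ℝ) / N) ((i + 1) / N),
        speedE (fun t => G (N * t)) t ≤ ENNReal.ofReal (N * dist (p i) (p (i + 1))) := by
      intro i hi t ht
      unfold speedE
      apply Filter.limsup_le_of_le
      · isBoundedDefault
      have hc : Tendsto (fun u : ℝ => t + u) (𝓝[≠] 0) (𝓝 t) := by
        have : Tendsto (fun u : ℝ => t + u) (𝓝 0) (𝓝 (t + 0)) :=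
          (continuous_const.add continuous_id).tendsto 0
        rw [add_zero] at this
        exact this.mono_left nhdsWithin_le_nhds
      filter_upwards [hc (Icc_mem_nhds ht.1 ht.2), self_mem_nhdsWithin] with u hu hu0
      have hu' : 0 < |u| := abs_pos.2 hu0
      apply ENNReal.ofReal_le_ofReal
      rw [div_le_iff₀ hu', hGiso i _ (hmem i hi _ hu) _ (hmem i hi t ⟨ht.1.le, ht.2.le⟩),
        show (N:ℝ) * t - N * (t + u) = -(N * u) by ring, abs_neg, abs_mul, abs_of_pos hN']
      exact le_of_eq (by ring)
    have hpiece : ∀ i < N, ∫⁻ t in Icc ((i:ℝ) / N) ((i + 1) / N), speedE (fun t => G (N * t)) t ^ 2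
        ≤ ENNReal.ofReal (N * dist (p i) (p (i + 1)) ^ 2) := by
      intro i hi
      rw [← restrict_Ioo_eq_restrict_Icc]
      calc _ ≤ ∫⁻ t in Ioo ((i:ℝ) / N) ((i + 1) / N),
            ENNReal.ofReal (N * dist (p i) (p (i + 1))) ^ 2 :=
            setLIntegral_mono' measurableSet_Ioo
              (fun t ht => pow_le_pow_left' (hspeed i hi t ht) 2)
        _ = _ := by
          rw [setLIntegral_const, Real.volume_Ioo, ← ENNReal.ofReal_pow (by positivity),
            ← ENNReal.ofReal_mul (by positivity)]
          congr 1
          field_simp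
          ring
    have hsum : ∫⁻ t in Icc (0:ℝ) 1, speedE (fun t => G (N * t)) t ^ 2 ≤
        ∑ i ∈ Finset.range N, ENNReal.ofReal (N * dist (p i) (p (i + 1)) ^ 2) := by
      calc _ ≤ ∫⁻ t in ⋃ i : Fin N, Icc (((i:ℕ):ℝ) / N) (((i:ℕ) + 1) / N),
            speedE (fun t => G (N * t)) t ^ 2 := by
            apply lintegral_mono_set
            intro t ht
            obtain ⟨i, hi, h⟩ := hcover t ht
            exact mem_iUnion.2 ⟨⟨i, hi⟩, h⟩
        _ ≤ _ := lintegral_iUnion_le _ _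
        _ ≤ _ := by
          rw [tsum_fintype, ← Fin.sum_univ_eq_sum_range
            (fun i => ENNReal.ofReal (N * dist (p i) (p (i + 1)) ^ 2))]
          exact Finset.sum_le_sum (fun i _ => hpiece i i.2)
    refine hsum.trans ?_
    rw [← ENNReal.ofReal_sum_of_nonneg (fun i _ => by positivity)]
    apply ENNReal.ofReal_le_ofReal
    have hterm : ∀ i ∈ Finset.range N, N * dist (p i) (p (i + 1)) ^ 2 ≤
        (1 + N * δ) * (e (((i + 1 : ℕ) : ℝ) / N) - e ((i:ℝ) / N)) + (4 * N * δ ^ 2 + 4 * δ) := by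
      intro i hi
      have hi := Finset.mem_range.1 hi
      have h1 := hL i hi
      have h2 := (he2 ((i:ℝ) / N) (((i + 1 : ℕ) : ℝ) / N) (by positivity)
        (by gcongr; simp) ((div_le_one hN').2 (Nat.cast_le.2 hi))).2
      rw [← sub_div, Nat.cast_add, Nat.cast_one, add_sub_cancel_left, div_mul_eq_mul_div, one_mul,
        le_div_iff₀ hN', ← Nat.cast_succ] at h2
      set d := dist (γ ((i:ℝ) / N)) (γ (((i + 1 : ℕ) : ℝ) / N))
      set L := dist (p i) (p (i + 1))
      have hL0 : 0 ≤ L := dist_nonneg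
      have hd0 : 0 ≤ d := dist_nonneg
      have h3 : L ^ 2 ≤ (d + 2 * δ) ^ 2 := pow_le_pow_left₀ hL0 h1 2
      have h4 : N * L ^ 2 ≤ N * (d + 2 * δ) ^ 2 := by gcongr
      have h5 : N * (d + 2 * δ) ^ 2 ≤ (1 + N * δ) * (d ^ 2 * N) + (4 * N * δ ^ 2 + 4 * δ) := by
        nlinarith [mul_nonneg hδ.le (sq_nonneg (N * d - 2))]
      have h6 : (1 + N * δ) * (d ^ 2 * N) ≤
        (1 + N * δ) * (e (((i + 1 : ℕ) : ℝ) / N) - e ((i:ℝ) / N)) :=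
        mul_le_mul_of_nonneg_left h2 (by positivity)
      linarith
    refine (Finset.sum_le_sum hterm).trans ?_
    rw [Finset.sum_add_distrib, ← Finset.mul_sum,
      Finset.sum_range_sub (fun i : ℕ => e ((i:ℝ) / N)), Finset.sum_const, Finset.card_range,
      nsmul_eq_mul, div_self hN'.ne', Nat.cast_zero, zero_div]
    have a := (he1 0 (by simp)).1
    have b := (he1 1 (by simp)).2
    have : (1 + N * δ) * (e 1 - e 0) ≤ (1 + N * δ) * C := by
      gcongr; linarith
    nlinarith
  · intro ω hω t ht
    obtain ⟨i, hi, hti⟩ := hcover t ht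
    have hi0 : (i:ℝ) / N ∈ Icc (0:ℝ) 1 := ⟨by positivity, (div_le_one hN').2 (Nat.cast_le.2 hi.le)⟩
    have hi1 : (((i + 1 : ℕ) : ℝ)) / N ∈ Icc (0:ℝ) 1 :=
      ⟨by positivity, (div_le_one hN').2 (Nat.cast_le.2 hi)⟩
    have hNt := hmem i hi t hti
    have a1 : dist (γ t) (γ ((i:ℝ) / N)) ≤ ω := by
      apply hω t ht _ hi0
      rw [abs_of_nonneg (by linarith [hti.1])]
      have := hti.2
      rw [add_div] at this
      linarith
    have a2 : dist (γ ((i:ℝ) / N)) (γ (((i + 1 : ℕ) : ℝ) / N)) ≤ ω := by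
      apply hω _ hi0 _ hi1
      rw [abs_sub_comm, ← sub_div, Nat.cast_add, Nat.cast_one, add_sub_cancel_left,
        abs_of_nonneg (by positivity)]
    have a3 := hp i
    rw [hmin1 i hi.le] at a3
    have a4 : dist (p i) (G (N * t)) ≤ ω + 2 * δ := by
      rw [← hGp i, hGiso i i ⟨le_rfl, by linarith⟩ _ hNt, abs_of_nonneg (by linarith [hNt.1])]
      have := hL i hi
      have h0 : 0 ≤ dist (p i) (p (i + 1)) := dist_nonneg
      nlinarith [hNt.2]
    have := dist_triangle4 (γ t) (γ ((i:ℝ) / N)) (p i) (G (N * t))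
    linarith


lemma aux_KE_iff {Y : Type*} [MetricSpace Y] {A : Set Y} {γ : ℝ → Y} {c : ℝ≥0∞} (hc : c ≠ ⊤) :
    kineticEnergyIn A γ ≤ c ↔ (∀ t ∈ Icc (0:ℝ) 1, γ t ∈ A) ∧ ACCurve γ ∧
      ∫⁻ t in Icc (0:ℝ) 1, speedE γ t ^ 2 ≤ ENNReal.ofReal (2 * c).toReal := by
  rw [ENNReal.ofReal_toReal (ENNReal.mul_ne_top (by simp) hc)]
  unfold kineticEnergyIn kineticEnergy
  split_ifs with h1 h2
  · rw [and_iff_right h1, and_iff_right h2]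
    rw [one_div, mul_comm, ← div_eq_mul_inv, ENNReal.div_le_iff (by simp) (by simp), mul_comm c]
  · simp [h2, hc]
  · exact ⟨fun h => absurd (top_le_iff.1 h) hc, fun h => absurd h.1 h1⟩

lemma aux_KE_const {Y : Type*} [MetricSpace Y] {A : Set Y} {x : Y} (hx : x ∈ A) :
    kineticEnergyIn A (fun _ => x) = 0 := by
  refine le_antisymm ((aux_KE_iff (by simp)).2 ⟨fun _ _ => hx, ⟨0, ?_, ?_⟩, ?_⟩) bot_le
  · exact integrableOn_zero
  · simp
  · have : ∀ t, speedE (fun _ : ℝ => x) t = 0 := by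
      intro t
      unfold speedE
      simp
    simp [this]

lemma aux_liminf {Y : Type*} [MetricSpace Y] [CompactSpace Y]
    (A : ℕ → Set Y) (Ainf : Set Y) (hcptinf : IsCompact Ainf)
    (hne : ∀ n, (A n).Nonempty) (hneinf : Ainf.Nonempty)
    (hH : Tendsto (fun n => Metric.hausdorffDist (A n) Ainf) atTop (𝓝 0))
    (γ : ℝ → Y) (g : ℕ → ℝ → Y)
    (hu : TendstoUniformlyOn (fun n t => g n t) γ atTop (Icc (0:ℝ) 1)) :
    kineticEnergyIn Ainf γ ≤ Filter.liminf (fun n => kineticEnergyIn (A n) (g n)) atTop := by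
  by_contra hcon
  rw [not_le] at hcon
  obtain ⟨c, hc1, hc2⟩ := exists_between hcon
  have hctop : c ≠ ⊤ := hc2.ne_top
  have hfr := frequently_lt_of_liminf_lt (by isBoundedDefault) hc1
  rw [frequently_iff_neBot] at hfr
  set U := Ultrafilter.of (atTop ⊓ 𝓟 {n | kineticEnergyIn (A n) (g n) < c})
  have hU : (U : Filter ℕ) ≤ atTop ⊓ 𝓟 {n | kineticEnergyIn (A n) (g n) < c} := Ultrafilter.of_le _
  have hU1 : (U : Filter ℕ) ≤ atTop := hU.trans inf_le_left
  have hU2 : ∀ᶠ n in (U : Filter ℕ), kineticEnergyIn (A n) (g n) ≤ c := by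
    have : ∀ᶠ n in (U : Filter ℕ), kineticEnergyIn (A n) (g n) < c :=
      le_principal_iff.1 (hU.trans inf_le_right)
    filter_upwards [this] with n hn using hn.le
  have hpt : ∀ t ∈ Icc (0:ℝ) 1, Tendsto (fun n => g n t) U (𝓝 (γ t)) := fun t ht =>
    (hu.tendsto_at ht).mono_left hU1
  have hA : ∀ t ∈ Icc (0:ℝ) 1, γ t ∈ Ainf := by
    intro t ht
    rw [hcptinf.isClosed.mem_iff_infDist_zero hneinf]
    refine le_antisymm ?_ infDist_nonneg
    have l1 : Tendsto (fun n => infDist (g n t) Ainf) U (𝓝 (infDist (γ t) Ainf)) :=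
      ((continuous_infDist_pt Ainf).tendsto _).comp (hpt t ht)
    refine le_of_tendsto_of_tendsto l1 (hH.mono_left hU1) ?_
    filter_upwards [hU2] with n hn
    exact infDist_le_hausdorffDist_of_mem (((aux_KE_iff hctop).1 hn).1 t ht)
      (hausdorffEDist_ne_top_of_nonempty_of_bounded (hne n) hneinf
        (isBounded_of_compactSpace) (isBounded_of_compactSpace))
  have := aux_lsc U (C := (2 * c).toReal) ENNReal.toReal_nonneg hpt (by
    filter_upwards [hU2] with n hn using ((aux_KE_iff hctop).1 hn).2)
  exact absurd ((aux_KE_iff hctop).2 ⟨hA, this⟩) (not_le.2 hc2)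

lemma aux_limsup {Y : Type*} [MetricSpace Y] [CompactSpace Y]
    (A : ℕ → Set Y) (Ainf : Set Y)
    (hne : ∀ n, (A n).Nonempty) (hneinf : Ainf.Nonempty)
    (hgeo : ∀ n, GeodesicSubset (A n))
    (hH : Tendsto (fun n => Metric.hausdorffDist (A n) Ainf) atTop (𝓝 0))
    (γ : ℝ → Y) (hγ : ContinuousOn γ (Icc (0:ℝ) 1)) :
    ∃ g : ℕ → ℝ → Y, (∀ n, ContinuousOn (g n) (Icc (0:ℝ) 1)) ∧
      TendstoUniformlyOn (fun n t => g n t) γ atTop (Icc (0:ℝ) 1) ∧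
      Filter.limsup (fun n => kineticEnergyIn (A n) (g n)) atTop ≤ kineticEnergyIn Ainf γ := by
  by_cases htop : kineticEnergyIn Ainf γ = ⊤
  · refine ⟨fun _ => γ, fun _ => hγ, ?_, by rw [htop]; exact le_top⟩
    rw [Metric.tendstoUniformlyOn_iff]
    intro ε hε
    filter_upwards with n t ht
    simpa using hε
  obtain ⟨hin, hac, hE⟩ := (aux_KE_iff htop).1 le_rfl
  set C := (2 * kineticEnergyIn Ainf γ).toReal with hCdef
  have hC : 0 ≤ C := ENNReal.toReal_nonneg
  set δ : ℕ → ℝ := fun n => hausdorffDist (A n) Ainf + 1 / ((n:ℝ) + 1) with hδdef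
  have hδpos : ∀ n, 0 < δ n := fun n =>
    add_pos_of_nonneg_of_pos hausdorffDist_nonneg (by positivity)
  have hδ0 : Tendsto δ atTop (𝓝 0) := by
    have := hH.add (tendsto_one_div_add_atTop_nhds_zero_nat (𝕜 := ℝ))
    rwa [add_zero] at this
  set N : ℕ → ℕ := fun n => ⌈(√(δ n))⁻¹⌉₊ with hNdef
  have hs0 : Tendsto (fun n => √(δ n)) atTop (𝓝 0) := by
    have := (Real.continuous_sqrt.tendsto 0).comp hδ0
    rwa [Real.sqrt_zero] at this
  have hspos : ∀ n, 0 < √(δ n) := fun n => Real.sqrt_pos.2 (hδpos n)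
  have hNpos : ∀ n, 0 < N n := fun n => Nat.ceil_pos.2 (inv_pos.2 (hspos n))
  have hNinv : ∀ n, 1 / (N n : ℝ) ≤ √(δ n) := by
    intro n
    rw [one_div]
    exact inv_le_of_inv_le₀ (hspos n) (Nat.le_ceil _)
  have hNδ : Tendsto (fun n => (N n : ℝ) * δ n) atTop (𝓝 0) := by
    have hup : Tendsto (fun n => √(δ n) + δ n) atTop (𝓝 0) := by simpa using hs0.add hδ0
    refine squeeze_zero (fun n => mul_nonneg (Nat.cast_nonneg _) (hδpos n).le) (fun n => ?_) hup
    have h1 : (N n : ℝ) ≤ (√(δ n))⁻¹ + 1 := (Nat.ceil_lt_add_one (inv_pos.2 (hspos n)).le).le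
    calc (N n : ℝ) * δ n ≤ ((√(δ n))⁻¹ + 1) * δ n := by
          gcongr; exact (hδpos n).le
      _ = (√(δ n))⁻¹ * (√(δ n) * √(δ n)) + δ n := by
          rw [Real.mul_self_sqrt (hδpos n).le]; ring
      _ = _ := by rw [← mul_assoc, inv_mul_cancel₀ (hspos n).ne', one_mul]
  have hnear : ∀ n, ∀ t ∈ Icc (0:ℝ) 1, ∃ y ∈ A n, dist (γ t) y ≤ δ n := by
    intro n t ht
    obtain ⟨y, hy, hd⟩ := exists_dist_lt_of_hausdorffDist_lt' (r := δ n) (hin t ht)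
      (show hausdorffDist (A n) Ainf < δ n by
        rw [hδdef]; exact lt_add_of_pos_right _ (by positivity))
      (hausdorffEDist_ne_top_of_nonempty_of_bounded (hne n) hneinf
        (isBounded_of_compactSpace) (isBounded_of_compactSpace))
    exact ⟨y, hy, by first | exact hd.le | (rw [dist_comm]; exact hd.le)⟩
  choose g hgc hgE hgd using fun n => aux_recover (hgeo n) hC hac hE (hNpos n) (hδpos n) (hnear n)
  refine ⟨g, hgc, ?_, ?_⟩
  · rw [Metric.tendstoUniformlyOn_iff]
    intro ε hε
    have huc := isCompact_Icc.uniformContinuousOn_of_continuous hγ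
    rw [Metric.uniformContinuousOn_iff] at huc
    obtain ⟨ρ, hρ, hω⟩ := huc (ε / 4) (by positivity)
    filter_upwards [hs0.eventually_lt_const hρ, hδ0.eventually_lt_const (show 0 < ε / 6 by positivity)]
      with n h1 h2 t ht
    have := hgd n (ε / 4) (fun s hs t ht hst => (hω s hs t ht (by
      rw [Real.dist_eq]; exact (hst.trans (hNinv n)).trans_lt h1)).le) t ht
    linarith
  · have hlim : Tendsto (fun n => 1 / 2 * ENNReal.ofReal
        ((1 + N n * δ n) * C + 4 * (N n * δ n) ^ 2 + 4 * (N n * δ n))) atTop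
        (𝓝 (1 / 2 * ENNReal.ofReal C)) := by
      apply ENNReal.Tendsto.const_mul _ (Or.inr (by simp))
      apply ENNReal.tendsto_ofReal
      have := (((hNδ.const_add 1).mul_const C).add ((hNδ.pow 2).const_mul 4)).add (hNδ.const_mul 4)
      simpa using this
    calc _ ≤ _ := Filter.limsup_le_limsup (Eventually.of_forall hgE)
      _ = _ := hlim.limsup_eq
      _ = _ := by
        rw [hCdef, ENNReal.ofReal_toReal (ENNReal.mul_ne_top (by simp) htop), ← mul_assoc, one_div,
          ENNReal.inv_mul_cancel (by simp) (by simp), one_mul]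

lemma aux_converse {Y : Type*} [MetricSpace Y] [CompactSpace Y]
    (A : ℕ → Set Y) (Ainf : Set Y) (hcptinf : IsCompact Ainf)
    (h1 : ∀ (γ : ℝ → Y) (g : ℕ → ℝ → Y), ContinuousOn γ (Icc (0:ℝ) 1) →
          (∀ n, ContinuousOn (g n) (Icc (0:ℝ) 1)) →
          TendstoUniformlyOn (fun n t => g n t) γ atTop (Icc (0:ℝ) 1) →
          kineticEnergyIn Ainf γ ≤ Filter.liminf (fun n => kineticEnergyIn (A n) (g n)) atTop)
    (h2 : ∀ γ : ℝ → Y, ContinuousOn γ (Icc (0:ℝ) 1) →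
          ∃ g : ℕ → ℝ → Y, (∀ n, ContinuousOn (g n) (Icc (0:ℝ) 1)) ∧
            TendstoUniformlyOn (fun n t => g n t) γ atTop (Icc (0:ℝ) 1) ∧
            Filter.limsup (fun n => kineticEnergyIn (A n) (g n)) atTop ≤
              kineticEnergyIn Ainf γ) :
    Tendsto (fun n => Metric.hausdorffDist (A n) Ainf) atTop (𝓝 0) := by
  have hmem : ∀ (B : Set Y) (γ : ℝ → Y), kineticEnergyIn B γ < ⊤ → γ 0 ∈ B := by
    intro B γ h
    exact ((aux_KE_iff h.ne).1 le_rfl).1 0 (by simp)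
  have hpt : ∀ x ∈ Ainf, Tendsto (fun n => infDist x (A n)) atTop (𝓝 0) := by
    intro x hx
    obtain ⟨g, -, hgu, hgl⟩ := h2 (fun _ => x) continuousOn_const
    rw [aux_KE_const hx] at hgl
    have hev : ∀ᶠ n in atTop, kineticEnergyIn (A n) (g n) < 1 :=
      eventually_lt_of_limsup_lt (hgl.trans_lt one_pos)
    have hd : Tendsto (fun n => dist x (g n 0)) atTop (𝓝 0) := by
      have := (hgu.tendsto_at (x := 0) (by simp))
      simpa using (tendsto_const_nhds (x := x)).dist this
    refine squeeze_zero' (Eventually.of_forall fun n => infDist_nonneg) ?_ hd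
    filter_upwards [hev] with n hn
    exact infDist_le_dist_of_mem (hmem _ _ (hn.trans ENNReal.one_lt_top))
  rw [Metric.tendsto_atTop']
  intro ε hε
  have ha : ∀ᶠ n in atTop, ∀ x ∈ A n, infDist x Ainf ≤ ε / 2 := by
    by_contra hcon
    rw [not_eventually] at hcon
    obtain ⟨φ, hφ, hφ'⟩ := extraction_of_frequently_atTop hcon
    push Not at hφ'
    choose x hxA hxd using hφ'
    obtain ⟨y, ψ, hψ, hy⟩ := CompactSpace.tendsto_subseq x
    have hθ : StrictMono (φ ∘ ψ) := hφ.comp hψ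
    -- the modified sequence
    classical
    let z : ℕ → Y := fun m => if h : ∃ k, φ (ψ k) = m then x (ψ h.choose) else y
    have hz : ∀ k, z (φ (ψ k)) = x (ψ k) := by
      intro k
      have h : ∃ j, φ (ψ j) = φ (ψ k) := ⟨k, rfl⟩
      have : h.choose = k := hθ.injective h.choose_spec
      simp only [z, dif_pos h, this]
    have hzt : Tendsto z atTop (𝓝 y) := by
      rw [Metric.tendsto_atTop] at hy ⊢
      intro η hη
      obtain ⟨M, hM⟩ := hy η hη
      refine ⟨φ (ψ M), fun m hm => ?_⟩
      by_cases h : ∃ k, φ (ψ k) = m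
      · obtain ⟨k, rfl⟩ := h
        rw [hz]
        exact hM k (hθ.le_iff_le.1 hm)
      · simp only [z, dif_neg h, dist_self]
        exact hη
    have hlim := h1 (fun _ => y) (fun n _ => z n) continuousOn_const (fun _ => continuousOn_const) (by
      rw [Metric.tendstoUniformlyOn_iff]
      intro η hη
      filter_upwards [(Metric.tendsto_nhds.1 hzt) η hη] with n hn t _
      rw [dist_comm]; exact hn)
    have hle : liminf (fun n => kineticEnergyIn (A n) (fun _ => z n)) atTop ≤ 0 := by
      apply liminf_le_of_frequently_le
      · rw [frequently_atTop]
        intro a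
        refine ⟨φ (ψ a), hθ.id_le a, ?_⟩
        rw [hz, aux_KE_const (hxA _)]
      · isBoundedDefault
    have hyA : y ∈ Ainf := hmem Ainf (fun _ => y) ((hlim.trans hle).trans_lt ENNReal.zero_lt_top)
    have hlim2 := ((continuous_infDist_pt Ainf).tendsto y).comp hy
    rw [infDist_zero_of_mem hyA] at hlim2
    obtain ⟨k, hk⟩ := (hlim2.eventually_lt_const (show 0 < ε / 2 by positivity)).exists
    exact absurd hk (not_lt.2 (hxd (ψ k)).le)
  have hb : ∀ᶠ n in atTop, ∀ x ∈ Ainf, infDist x (A n) ≤ ε / 2 := by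
    by_contra hcon
    rw [not_eventually] at hcon
    obtain ⟨φ, hφ, hφ'⟩ := extraction_of_frequently_atTop hcon
    push Not at hφ'
    choose x hxA hxd using hφ'
    obtain ⟨y, hyA, ψ, hψ, hy⟩ := hcptinf.tendsto_subseq hxA
    have l1 := ((hpt y hyA).comp (hφ.tendsto_atTop.comp hψ.tendsto_atTop))
    have l2 := hy.dist (tendsto_const_nhds (x := y))
    rw [dist_self] at l2
    have l3 := l1.add l2
    rw [add_zero] at l3
    obtain ⟨k, hk⟩ := (l3.eventually_lt_const (show 0 < ε / 2 by positivity)).exists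
    have := hxd (ψ k)
    have h4 : infDist (x (ψ k)) (A (φ (ψ k))) ≤ infDist y (A (φ (ψ k))) + dist (x (ψ k)) y :=
      infDist_le_infDist_add_dist
    simp only [Function.comp] at hk
    linarith
  obtain ⟨M, hM⟩ := (ha.and hb).exists_forall_of_atTop
  refine ⟨M, fun n hn => ?_⟩
  rw [Real.dist_eq, sub_zero, abs_of_nonneg hausdorffDist_nonneg]
  obtain ⟨q1, q2⟩ := hM n hn.le
  linarith [hausdorffDist_le_of_infDist (by positivity : (0:ℝ) ≤ ε / 2) q1 q2]

/-- Gromov–Hausdorff convergence vs Γ-convergence of kinetic energies: for compact geodesic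
subsets `A n` and `A∞` of a compact space `Y`, the sets `A n` converge to `A∞` in the Hausdorff
distance if and only if the extended kinetic energy functionals `KE-hat_{A n}` Γ-converge to
`KE-hat_{A∞}` on `C([0,1],Y)` with respect to uniform convergence. -/
theorem hausdorff_tendsto_iff_gamma_kineticEnergy {Y : Type*} [MetricSpace Y] [CompactSpace Y]
    (A : ℕ → Set Y) (Ainf : Set Y)
    (hcpt : ∀ n, IsCompact (A n)) (hcptinf : IsCompact Ainf)
    (hne : ∀ n, (A n).Nonempty) (hneinf : Ainf.Nonempty)
    (hgeo : ∀ n, GeodesicSubset (A n)) (hgeoinf : GeodesicSubset Ainf) :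
    Tendsto (fun n => Metric.hausdorffDist (A n) Ainf) atTop (𝓝 0) ↔
      ((∀ (γ : ℝ → Y) (g : ℕ → ℝ → Y), ContinuousOn γ (Icc (0:ℝ) 1) →
          (∀ n, ContinuousOn (g n) (Icc (0:ℝ) 1)) →
          TendstoUniformlyOn (fun n t => g n t) γ atTop (Icc (0:ℝ) 1) →
          kineticEnergyIn Ainf γ ≤ Filter.liminf (fun n => kineticEnergyIn (A n) (g n)) atTop) ∧
       (∀ γ : ℝ → Y, ContinuousOn γ (Icc (0:ℝ) 1) →
          ∃ g : ℕ → ℝ → Y, (∀ n, ContinuousOn (g n) (Icc (0:ℝ) 1)) ∧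
            TendstoUniformlyOn (fun n t => g n t) γ atTop (Icc (0:ℝ) 1) ∧
            Filter.limsup (fun n => kineticEnergyIn (A n) (g n)) atTop ≤
              kineticEnergyIn Ainf γ)) := by

  constructor
  · intro hH
    exact ⟨fun γ g _ _ hu => aux_liminf A Ainf hcptinf hne hneinf hH γ g hu,
      fun γ hγ => aux_limsup A Ainf hne hneinf hgeo hH γ hγ⟩
  · rintro ⟨h1, h2⟩
    exact aux_converse A Ainf hcptinf h1 h2
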